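/- Let T > 0, let I_0, …, I_N be pairwise disjoint open subintervals of (0, T), and let λ_0, …, λ_N ∈ ℝ. If μ( (⋃_{k=0}^{N} r(I_k − λ_k))ᶜ ) = 0, then T ≥ 2π. (In particular, the optimal control time for any family of alternating boundary observations of the one-dimensional wave equation is at least 2π.) -/

import Mathlib

open MeasureTheory Set Real Filter Topology

noncomputable section

instance : Fact (0 < 2 * Real.pi) := ⟨by positivity⟩

/-- Remark 1.5: if pairwise disjoint open subintervals (a_k, b_k) of (0,T), shifted
by −λ_k and projected to the circle ℝ/(2πℤ), cover it up to a null set, then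
T ≥ 2π. In particular the optimal control time is at least 2π. -/
theorem stmt_4 (T : ℝ) (hT : 0 < T) (N : ℕ) (a b lamv : Fin (N + 1) → ℝ)
    (hsub : ∀ k, Set.Ioo (a k) (b k) ⊆ Set.Ioo 0 T)
    (hdisj : Pairwise (Function.onFun Disjoint fun k => Set.Ioo (a k) (b k)))
    (hcov : volume ((⋃ k,
        (fun x : ℝ => ((x - lamv k : ℝ) : AddCircle (2 * Real.pi))) ''
          Set.Ioo (a k) (b k))ᶜ) = 0) :
    2 * Real.pi ≤ T := by
  by_contra hlt
  have key : ∀ k, volume ((fun x : ℝ => ((x - lamv k : ℝ) : AddCircle (2 * Real.pi))) ''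
      Set.Ioo (a k) (b k)) ≤ volume (Set.Ioo (a k) (b k)) := by
    intro k
    have hs : (fun x : ℝ => ((x - lamv k : ℝ) : AddCircle (2 * Real.pi))) ''
        Set.Ioo (a k) (b k) ⊆ Metric.closedBall
          ((((a k + b k) / 2 - lamv k : ℝ)) : AddCircle (2 * Real.pi)) ((b k - a k) / 2) := by
      rintro _ ⟨x, hx, rfl⟩
      rw [Metric.mem_closedBall, dist_eq_norm, ← AddCircle.coe_sub]
      refine (QuotientAddGroup.norm_mk_le_norm).trans ?_
      rw [Real.norm_eq_abs, abs_le]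
      constructor <;> linarith [hx.1, hx.2]
    refine (measure_mono hs).trans ?_
    rw [AddCircle.volume_closedBall, Real.volume_Ioo]
    apply ENNReal.ofReal_le_ofReal
    refine (min_le_right _ _).trans (by linarith)
  have h1 : volume (Set.univ : Set (AddCircle (2 * Real.pi))) ≤ ENNReal.ofReal T := by
    calc volume (Set.univ : Set (AddCircle (2 * Real.pi)))
        ≤ volume (⋃ k, (fun x : ℝ => ((x - lamv k : ℝ) : AddCircle (2 * Real.pi))) ''
          Set.Ioo (a k) (b k)) + 0 := by
          rw [← hcov, ← Set.union_compl_self]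
          exact measure_union_le _ _
      _ ≤ ∑' k, volume (Set.Ioo (a k) (b k)) := by
          rw [add_zero]
          exact (measure_iUnion_le _).trans (ENNReal.tsum_le_tsum key)
      _ = volume (⋃ k, Set.Ioo (a k) (b k)) :=
          (measure_iUnion hdisj fun _ => measurableSet_Ioo).symm
      _ ≤ volume (Set.Ioo 0 T) := measure_mono (Set.iUnion_subset hsub)
      _ = ENNReal.ofReal T := by rw [Real.volume_Ioo, sub_zero]
  rw [AddCircle.measure_univ, ENNReal.ofReal_le_ofReal_iff hT.le] at h1
  exact hlt h1
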